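/- Let p be an odd prime, λ ∈ ℚ_p with ‖λ‖_p > 1, and let f : ℤ_p → ℤ_p be everywhere analytic with integral coefficients. Then there exists a sequence (c_n) in ℚ_p such that for every s ∈ ℚ_p with ‖s‖_p < p^{(p−2)/(p−1)}: the Volkenborn integral ∫_{ℤ_p} ⟨λ+f(a)⟩^{1−s} da exists, the series Σ_{n=0}^∞ c_n s^n converges, and ∫_{ℤ_p} ⟨λ+f(a)⟩^{1−s} da = Σ_{n=0}^∞ c_n s^n; consequently ζ_p^f(s,λ) := (s−1)^{−1} ∫_{ℤ_p} ⟨λ+f(a)⟩^{1−s} da is analytic on the disc ‖s‖_p < p^{(p−2)/(p−1)} except for a simple pole at s = 1. -/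

import Mathlib

open Filter Topology

namespace PZeta

variable (p : ℕ) [Fact p.Prime]

/-- The `N`-th partial sum defining the fermionic integral
`∫_{ℤ_p} g dμ₋₁ = lim_N Σ_{a=0}^{p^N-1} (-1)^a g(a)`. -/
noncomputable def fermSum (g : ℤ_[p] → ℚ_[p]) (N : ℕ) : ℚ_[p] :=
  ∑ a ∈ Finset.range (p ^ N), (-1 : ℚ_[p]) ^ a * g (a : ℤ_[p])

/-- The `N`-th partial sum defining the Volkenborn integral
`∫_{ℤ_p} g da = lim_N p^{-N} Σ_{a=0}^{p^N-1} g(a)`. -/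
noncomputable def volkSum (g : ℤ_[p] → ℚ_[p]) (N : ℕ) : ℚ_[p] :=
  ((p : ℚ_[p]) ^ N)⁻¹ * ∑ a ∈ Finset.range (p ^ N), g (a : ℤ_[p])

/-- The unit part `x·p^{-v_p(x)}` of a nonzero `p`-adic number. -/
noncomputable def unitPart (x : ℚ_[p]) : ℚ_[p] := x * (p : ℚ_[p]) ^ (-x.valuation)

/-- The Teichmüller representative of a `p`-adic unit, `lim_n x^{p^n}`. -/
noncomputable def teich (x : ℚ_[p]) : ℚ_[p] :=
  limUnder atTop fun n : ℕ => x ^ p ^ n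

/-- The projection `⟨x⟩ ∈ 1 + pℤ_p`, via `x = p^{v_p(x)}·ζ·⟨x⟩`. -/
noncomputable def angle (x : ℚ_[p]) : ℚ_[p] := unitPart p x / teich p (unitPart p x)

/-- `ω_v(x) := x / ⟨x⟩ = p^{v_p(x)}·ζ`. -/
noncomputable def omegaV (x : ℚ_[p]) : ℚ_[p] := x / angle p x

/-- The generalized binomial coefficient `C(t,n) = t(t-1)⋯(t-n+1)/n!`. -/
noncomputable def gbinom (t : ℚ_[p]) (n : ℕ) : ℚ_[p] :=
  (∏ i ∈ Finset.range n, (t - (i : ℚ_[p]))) / (n.factorial : ℚ_[p])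

/-- The power `y^t` defined by the binomial series `Σ_n C(t,n)(y-1)^n`
(used for `y ∈ 1 + pℤ_p` and `t ∈ ℤ_p`). -/
noncomputable def bpow (y t : ℚ_[p]) : ℚ_[p] := ∑' n : ℕ, gbinom p t n * (y - 1) ^ n

/-- The Iwasawa `p`-adic logarithm: `log_p x = Σ_{n≥1} (-1)^{n+1}(⟨x⟩-1)^n/n`
(one has `log_p p = 0` and `log_p ζ = 0` for roots of unity of order prime to `p`). -/
noncomputable def padicLog (x : ℚ_[p]) : ℚ_[p] :=
  ∑' n : ℕ, (-1 : ℚ_[p]) ^ n * (angle p x - 1) ^ (n + 1) / ((n : ℚ_[p]) + 1)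

/-- The power `y^t` defined by the exponential series `Σ_n (t·log_p y)^n/n!`
(used for `y ∈ 1 + pℤ_p` and `‖t‖ < p^{(p-2)/(p-1)}`). -/
noncomputable def epow (y t : ℚ_[p]) : ℚ_[p] :=
  ∑' n : ℕ, (t * padicLog p y) ^ n / (n.factorial : ℚ_[p])

/-- `f : ℤ_p → ℤ_p` is everywhere analytic with integral coefficients:
`f(x) = Σ_k c_k x^k` with `‖c_k‖ ≤ 1`, `c_k → 0`. -/
def EverywhereAnalytic (f : ℤ_[p] → ℤ_[p]) : Prop :=
  ∃ c : ℕ → ℚ_[p], (∀ k, ‖c k‖ ≤ 1) ∧ Tendsto c atTop (𝓝 0) ∧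
    ∀ x : ℤ_[p], (f x : ℚ_[p]) = ∑' k : ℕ, c k * (x : ℚ_[p]) ^ k

/-- The `p`-adic Hurwitz-type Euler zeta function w.r.t. `f`:
`ζ_{p,E}^f(s,λ) = ∫_{ℤ_p} ⟨λ+f(a)⟩^{1-s} dμ₋₁(a)`. -/
noncomputable def zetaE (f : ℤ_[p] → ℤ_[p]) (s : ℤ_[p]) (lam : ℚ_[p]) : ℚ_[p] :=
  limUnder atTop
    (fermSum p fun a => bpow p (angle p (lam + (f a : ℚ_[p]))) (1 - (s : ℚ_[p])))

/-- The `p`-adic Hurwitz zeta function w.r.t. `f`: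
`ζ_p^f(s,λ) = (s-1)⁻¹ ∫_{ℤ_p} ⟨λ+f(a)⟩^{1-s} da`. -/
noncomputable def zetaH (f : ℤ_[p] → ℤ_[p]) (s : ℤ_[p]) (lam : ℚ_[p]) : ℚ_[p] :=
  ((s : ℚ_[p]) - 1)⁻¹ *
    limUnder atTop
      (volkSum p fun a => bpow p (angle p (lam + (f a : ℚ_[p]))) (1 - (s : ℚ_[p])))

end PZeta

open PZeta

namespace PZeta

section SmoothBound

variable {p : ℕ} [Fact p.Prime]

/-- `g` and its first and second difference quotients are bounded by `r`. -/
structure SmoothBound (r : ℝ) (g : ℤ_[p] → ℚ_[p]) : Prop where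
  norm_le : ∀ x, ‖g x‖ ≤ r
  diff_le : ∀ x h, ‖g (x + h) - g x‖ ≤ r * ‖h‖
  diff_diff_le : ∀ x h k, ‖g (x + h + k) - g (x + h) - g (x + k) + g x‖ ≤ r * ‖h‖ * ‖k‖

theorem norm_add_le_of_le {x y : ℚ_[p]} {r : ℝ} (hx : ‖x‖ ≤ r) (hy : ‖y‖ ≤ r) :
    ‖x + y‖ ≤ r :=
  (IsUltrametricDist.norm_add_le_max x y).trans (max_le hx hy)

namespace SmoothBound

variable {r r' : ℝ} {g g' : ℤ_[p] → ℚ_[p]}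

theorem nonneg (hg : SmoothBound r g) : 0 ≤ r := (norm_nonneg _).trans (hg.norm_le 0)

theorem mono (hg : SmoothBound r g) (h : r ≤ r') : SmoothBound r' g where
  norm_le x := (hg.norm_le x).trans h
  diff_le x k := (hg.diff_le x k).trans (by gcongr)
  diff_diff_le x k l := (hg.diff_diff_le x k l).trans (by gcongr)

theorem const {c : ℚ_[p]} (hc : ‖c‖ ≤ r) : SmoothBound (p := p) r fun _ => c := by
  have : 0 ≤ r := (norm_nonneg _).trans hc
  refine ⟨fun _ => hc, fun x h => ?_, fun x h k => ?_⟩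
  · simpa using by positivity
  · simpa using by positivity

theorem coe : SmoothBound (p := p) 1 fun x => (x : ℚ_[p]) := by
  refine ⟨fun x => ?_, fun x h => ?_, fun x h k => ?_⟩
  · simpa using x.norm_le_one
  · simp
  · have : (((x + h + k : ℤ_[p]) : ℚ_[p]) - ((x + h : ℤ_[p]) : ℚ_[p])
        - ((x + k : ℤ_[p]) : ℚ_[p]) + (x : ℚ_[p])) = 0 := by
      push_cast; ring
    rw [this]; simpa using by positivity

theorem add (hg : SmoothBound r g) (hg' : SmoothBound r g') :
    SmoothBound r fun x => g x + g' x where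
  norm_le x := norm_add_le_of_le (hg.norm_le x) (hg'.norm_le x)
  diff_le x h := by
    rw [add_sub_add_comm]
    exact norm_add_le_of_le (hg.diff_le x h) (hg'.diff_le x h)
  diff_diff_le x h k := by
    convert norm_add_le_of_le (hg.diff_diff_le x h k) (hg'.diff_diff_le x h k) using 2
    ring

theorem mul (hg : SmoothBound r g) (hg' : SmoothBound r' g') :
    SmoothBound (r * r') fun x => g x * g' x where
  norm_le x := by
    rw [norm_mul]
    exact mul_le_mul (hg.norm_le x) (hg'.norm_le x) (norm_nonneg _) hg.nonneg
  diff_le x h := by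
    have key : g (x + h) * g' (x + h) - g x * g' x =
        g (x + h) * (g' (x + h) - g' x) + (g (x + h) - g x) * g' x := by ring
    rw [key]
    apply norm_add_le_of_le <;> rw [norm_mul]
    · calc _ ≤ r * (r' * ‖h‖) :=
            mul_le_mul (hg.norm_le _) (hg'.diff_le x h) (norm_nonneg _) hg.nonneg
        _ = _ := by ring
    · calc _ ≤ (r * ‖h‖) * r' :=
            mul_le_mul (hg.diff_le x h) (hg'.norm_le _) (norm_nonneg _)
              (mul_nonneg hg.nonneg (norm_nonneg _))
        _ = _ := by ring
  diff_diff_le x h k := by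
    have hr := hg.nonneg
    have hk : ‖g (x + h + k) - g (x + k)‖ ≤ r * ‖h‖ := by
      rw [add_right_comm]; exact hg.diff_le _ _
    have key : g (x + h + k) * g' (x + h + k) - g (x + h) * g' (x + h)
          - g (x + k) * g' (x + k) + g x * g' x =
        (g (x + h + k) * (g' (x + h + k) - g' (x + h) - g' (x + k) + g' x) +
          (g (x + h + k) - g (x + h)) * (g' (x + h) - g' x)) +
        ((g (x + h + k) - g (x + k)) * (g' (x + k) - g' x) +
          (g (x + h + k) - g (x + h) - g (x + k) + g x) * g' x) := by ring
    rw [key]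
    apply norm_add_le_of_le <;> apply norm_add_le_of_le <;> rw [norm_mul]
    · calc _ ≤ r * (r' * ‖h‖ * ‖k‖) :=
            mul_le_mul (hg.norm_le _) (hg'.diff_diff_le x h k) (norm_nonneg _) hr
        _ = _ := by ring
    · calc _ ≤ (r * ‖k‖) * (r' * ‖h‖) :=
            mul_le_mul (hg.diff_le _ _) (hg'.diff_le _ _) (norm_nonneg _) (by positivity)
        _ = _ := by ring
    · calc _ ≤ (r * ‖h‖) * (r' * ‖k‖) :=
            mul_le_mul hk (hg'.diff_le _ _) (norm_nonneg _) (by positivity)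
        _ = _ := by ring
    · calc _ ≤ (r * ‖h‖ * ‖k‖) * r' :=
            mul_le_mul (hg.diff_diff_le x h k) (hg'.norm_le _) (norm_nonneg _) (by positivity)
        _ = _ := by ring

theorem const_mul (c : ℚ_[p]) (hg : SmoothBound r g) :
    SmoothBound (‖c‖ * r) fun x => c * g x :=
  (const le_rfl).mul hg

theorem pow (hg : SmoothBound r g) : ∀ n : ℕ, SmoothBound (r ^ n) fun x => g x ^ n
  | 0 => by simpa using const (p := p) (c := 1) (by simp)
  | n + 1 => by simpa only [pow_succ] using (hg.pow n).mul hg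

theorem sum {ι : Type*} {G : ι → ℤ_[p] → ℚ_[p]} (hr : 0 ≤ r) (hG : ∀ i, SmoothBound r (G i))
    (s : Finset ι) : SmoothBound r fun x => ∑ i ∈ s, G i x := by
  classical
  induction s using Finset.induction_on with
  | empty => simpa using const (p := p) (c := 0) (by simpa using hr)
  | insert i s hi ih =>
    simp only [Finset.sum_insert hi]
    exact (hG i).add ih

theorem of_tendsto {ι : Type*} {l : Filter ι} [l.NeBot] {G : ι → ℤ_[p] → ℚ_[p]}
    (hG : ∀ i, SmoothBound r (G i)) (hlim : ∀ x, Tendsto (fun i => G i x) l (𝓝 (g x))) :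
    SmoothBound r g where
  norm_le x := le_of_tendsto (hlim x).norm (.of_forall fun i => (hG i).norm_le x)
  diff_le x h := le_of_tendsto ((hlim _).sub (hlim _)).norm
    (.of_forall fun i => (hG i).diff_le x h)
  diff_diff_le x h k := le_of_tendsto
    ((((hlim _).sub (hlim _)).sub (hlim _)).add (hlim _)).norm
    (.of_forall fun i => (hG i).diff_diff_le x h k)

theorem tsum {ι : Type*} {G : ι → ℤ_[p] → ℚ_[p]} (hr : 0 ≤ r) (hG : ∀ i, SmoothBound r (G i))
    (hs : ∀ x, Summable fun i => G i x) : SmoothBound r fun x => ∑' i, G i x :=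
  of_tendsto (fun s => sum hr hG s) fun x => (hs x).hasSum

/-- First-order expansion along an arithmetic progression. -/
theorem norm_sub_sub_nsmul_le (hg : SmoothBound r g) (x h : ℤ_[p]) (b : ℕ) :
    ‖g (x + b * h) - g x - b * (g (x + h) - g x)‖ ≤ r * ‖h‖ ^ 2 := by
  have hr := hg.nonneg
  induction b with
  | zero => simpa using by positivity
  | succ b ih =>
    have key : g (x + (b + 1 : ℕ) * h) - g x - (b + 1 : ℕ) * (g (x + h) - g x) =
        (g (x + b * h) - g x - b * (g (x + h) - g x)) +
          (g (x + b * h + h) - g (x + b * h) - g (x + h) + g x) := by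
      have : x + (b + 1 : ℕ) * h = x + b * h + h := by push_cast; ring
      rw [this]; push_cast; ring
    rw [key]
    refine norm_add_le_of_le ih ((hg.diff_diff_le x (b * h) h).trans ?_)
    calc r * ‖(b : ℤ_[p]) * h‖ * ‖h‖ ≤ r * (1 * ‖h‖) * ‖h‖ := by
          rw [norm_mul]; gcongr; exact PadicInt.norm_le_one _
      _ = _ := by ring

end SmoothBound

theorem sum_range_mul_eq {M : Type*} [AddCommMonoid M] (F : ℕ → M) (m n : ℕ) :
    ∑ a ∈ Finset.range (m * n), F a =
      ∑ a ∈ Finset.range m, ∑ b ∈ Finset.range n, F (a + b * m) := by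
  rw [Finset.sum_comm]
  induction n with
  | zero => simp
  | succ n ih =>
    rw [Nat.mul_succ, Finset.sum_range_add, ih, Finset.sum_range_succ]
    congr 1
    exact Finset.sum_congr rfl fun a _ => by rw [add_comm, mul_comm]

/-- Sums of a Lipschitz function over `{0, …, p ^ N - 1}` are small. -/
theorem norm_sum_range_pow_le {M : ℝ} {h : ℤ_[p] → ℚ_[p]} (hb : ∀ x, ‖h x‖ ≤ M)
    (hl : ∀ x y, ‖h (x + y) - h x‖ ≤ M * ‖y‖) (N : ℕ) :
    ‖∑ a ∈ Finset.range (p ^ N), h a‖ ≤ M * p * ((p : ℝ)⁻¹) ^ N := by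
  have hM : 0 ≤ M := (norm_nonneg _).trans (hb 0)
  have hp : (1 : ℝ) < p := by exact_mod_cast (Fact.out : p.Prime).one_lt
  have hp0 : (0 : ℝ) < p := by linarith
  induction N with
  | zero => simpa using (hb 0).trans (le_mul_of_one_le_right hM hp.le)
  | succ N ih =>
    have key : ∑ a ∈ Finset.range (p ^ (N + 1)), h a =
        ∑ a ∈ Finset.range (p ^ N), ∑ b ∈ Finset.range p, (h (a + b * (p : ℤ_[p]) ^ N) - h a) +
          p * ∑ a ∈ Finset.range (p ^ N), h a := by
      rw [pow_succ, sum_range_mul_eq (fun a : ℕ => h a)]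
      simp [Finset.sum_sub_distrib, Finset.mul_sum]
    rw [key]
    have e : M * p * ((p : ℝ)⁻¹) ^ (N + 1) = M * ((p : ℝ)⁻¹) ^ N := by
      rw [pow_succ]; field_simp
    rw [e]
    apply norm_add_le_of_le
    · refine IsUltrametricDist.norm_sum_le_of_forall_le_of_nonneg (by positivity) fun a _ =>
        IsUltrametricDist.norm_sum_le_of_forall_le_of_nonneg (by positivity) fun b _ => ?_
      refine (hl _ _).trans ?_
      rw [norm_mul, norm_pow, PadicInt.norm_p]
      gcongr
      exact mul_le_of_le_one_left (by positivity) (PadicInt.norm_le_one _)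
    · rw [norm_mul, Padic.norm_p]
      calc _ ≤ (p : ℝ)⁻¹ * (M * p * ((p : ℝ)⁻¹) ^ N) := by gcongr
        _ = _ := by field_simp

namespace SmoothBound

variable {r : ℝ} {g : ℤ_[p] → ℚ_[p]}

theorem norm_volkSum_succ_sub_le (hp : Odd p) (hg : SmoothBound r g) (N : ℕ) :
    ‖volkSum p g (N + 1) - volkSum p g N‖ ≤ r * p * ((p : ℝ)⁻¹) ^ N := by
  have hr := hg.nonneg
  have hp1 : (1 : ℝ) < p := by exact_mod_cast (Fact.out : p.Prime).one_lt
  have hp0 : (0 : ℝ) < p := by linarith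
  have hpQ : (p : ℚ_[p]) ≠ 0 := by exact_mod_cast (Fact.out : p.Prime).ne_zero
  obtain ⟨m, hm⟩ := hp
  set q : ℤ_[p] := (p : ℤ_[p]) ^ N with hq
  have hqn : ‖q‖ = ((p : ℝ)⁻¹) ^ N := by rw [hq, norm_pow, PadicInt.norm_p]
  have hgauss : ∑ b ∈ Finset.range p, (b : ℚ_[p]) = p * m := by
    have : ∑ b ∈ Finset.range p, b = p * m := by
      have := Finset.sum_range_id_mul_two p
      have h2 : p - 1 = 2 * m := by omega
      rw [h2] at this
      nlinarith
    have := congrArg (Nat.cast (R := ℚ_[p])) this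
    push_cast at this
    exact this
  have key : volkSum p g (N + 1) - volkSum p g N =
      ((p : ℚ_[p]) ^ (N + 1))⁻¹ *
        (∑ a ∈ Finset.range (p ^ N), ∑ b ∈ Finset.range p,
            (g (a + b * q) - g a - b * (g (a + q) - g a)) +
          p * m * ∑ a ∈ Finset.range (p ^ N), (g (a + q) - g a)) := by
    have h1 : ∑ a ∈ Finset.range (p ^ (N + 1)), g a =
        ∑ a ∈ Finset.range (p ^ N), ∑ b ∈ Finset.range p,
            (g (a + b * q) - g a - b * (g (a + q) - g a)) +
          p * m * ∑ a ∈ Finset.range (p ^ N), (g (a + q) - g a) +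
          p * ∑ a ∈ Finset.range (p ^ N), g a := by
      rw [pow_succ, sum_range_mul_eq (fun a : ℕ => g a), Finset.mul_sum, Finset.mul_sum,
        ← Finset.sum_add_distrib, ← Finset.sum_add_distrib]
      refine Finset.sum_congr rfl fun a _ => ?_
      simp only [Finset.sum_sub_distrib, ← Finset.sum_mul, hgauss]
      simp [hq]
    rw [volkSum, volkSum, h1]
    field_simp
    ring
  rw [key, norm_mul, norm_inv, norm_pow, Padic.norm_p]
  have hin : ∀ z : ℚ_[p], ‖z‖ ≤ r * (((p : ℝ)⁻¹) ^ N) ^ 2 →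
      (((p : ℝ)⁻¹) ^ (N + 1))⁻¹ * ‖z‖ ≤ r * p * ((p : ℝ)⁻¹) ^ N := fun z hz => by
    calc _ ≤ (((p : ℝ)⁻¹) ^ (N + 1))⁻¹ * (r * (((p : ℝ)⁻¹) ^ N) ^ 2) := by gcongr
      _ = _ := by rw [pow_succ]; field_simp
  refine hin _ (norm_add_le_of_le ?_ ?_)
  · refine IsUltrametricDist.norm_sum_le_of_forall_le_of_nonneg (by positivity) fun a _ =>
      IsUltrametricDist.norm_sum_le_of_forall_le_of_nonneg (by positivity) fun b _ => ?_
    rw [← hqn]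
    exact hg.norm_sub_sub_nsmul_le _ _ _
  · have h1 : ‖∑ a ∈ Finset.range (p ^ N), (g (a + q) - g a)‖ ≤
        (r * ‖q‖) * p * ((p : ℝ)⁻¹) ^ N := by
      refine norm_sum_range_pow_le (h := fun x => g (x + q) - g x) (fun x => hg.diff_le x q)
        (fun x y => ?_) N
      convert hg.diff_diff_le x q y using 2
      rw [add_right_comm]; ring
    rw [norm_mul, norm_mul, Padic.norm_p]
    calc _ ≤ (p : ℝ)⁻¹ * 1 * ((r * ‖q‖) * p * ((p : ℝ)⁻¹) ^ N) := by
          gcongr; exact_mod_cast Padic.norm_int_le_one (p := p) m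
      _ = _ := by rw [hqn]; field_simp

theorem norm_volkSum_le (hp : Odd p) (hg : SmoothBound r g) (N : ℕ) :
    ‖volkSum p g N‖ ≤ r * p := by
  have hr := hg.nonneg
  have hp1 : (1 : ℝ) < p := by exact_mod_cast (Fact.out : p.Prime).one_lt
  induction N with
  | zero => simpa [volkSum] using (hg.norm_le 0).trans (le_mul_of_one_le_right hr hp1.le)
  | succ N ih =>
    rw [← sub_add_cancel (volkSum p g (N + 1)) (volkSum p g N)]
    refine norm_add_le_of_le ((hg.norm_volkSum_succ_sub_le hp N).trans ?_) ih
    exact mul_le_of_le_one_right (by positivity)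
      (pow_le_one₀ (by positivity) (inv_le_one_of_one_le₀ hp1.le))

/-- The Volkenborn integral of a function with bounded second differences exists. -/
theorem exists_tendsto_volkSum (hp : Odd p) (hg : SmoothBound r g) :
    ∃ I, ‖I‖ ≤ r * p ∧ Tendsto (volkSum p g) atTop (𝓝 I) := by
  have hp1 : (1 : ℝ) < p := by exact_mod_cast (Fact.out : p.Prime).one_lt
  have hc : CauchySeq (volkSum p g) :=
    cauchySeq_of_le_geometric (p : ℝ)⁻¹ (r * p) (inv_lt_one_of_one_lt₀ hp1) fun N => by
      rw [dist_comm, dist_eq_norm]; exact hg.norm_volkSum_succ_sub_le hp N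
  obtain ⟨I, hI⟩ := cauchySeq_tendsto_of_complete hc
  exact ⟨I, le_of_tendsto hI.norm (.of_forall fun N => hg.norm_volkSum_le hp N), hI⟩

end SmoothBound

end SmoothBound

end PZeta

namespace PZeta

section Angle

variable {p : ℕ} [Fact p.Prime]

theorem norm_pow_prime_pow_sub_le {a b : ℤ_[p]} (h : (p : ℤ_[p]) ∣ a - b) (n : ℕ) :
    ‖(a : ℚ_[p]) ^ p ^ n - (b : ℚ_[p]) ^ p ^ n‖ ≤ (p : ℝ)⁻¹ * ((p : ℝ)⁻¹) ^ n := by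
  have h1 := dvd_sub_pow_of_dvd_sub h n
  rw [← Ideal.mem_span_singleton, ← PadicInt.norm_le_pow_iff_mem_span_pow] at h1
  have h2 : ‖(a : ℚ_[p]) ^ p ^ n - (b : ℚ_[p]) ^ p ^ n‖ = ‖a ^ p ^ n - b ^ p ^ n‖ := by
    rw [PadicInt.norm_def]; push_cast; rfl
  rw [h2]
  refine h1.trans (le_of_eq ?_)
  rw [zpow_neg, zpow_natCast, pow_succ, mul_inv, inv_pow, mul_comm]

theorem dvd_pow_prime_sub_self (x : ℤ_[p]) : (p : ℤ_[p]) ∣ x ^ p - x := by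
  rw [← Ideal.mem_span_singleton, ← PadicInt.maximalIdeal_eq_span_p, ← PadicInt.ker_toZMod,
    RingHom.mem_ker]
  simp

theorem inv_prime_lt_one : (p : ℝ)⁻¹ < 1 :=
  inv_lt_one_of_one_lt₀ (by exact_mod_cast (Fact.out : p.Prime).one_lt)

theorem dvd_of_norm_le_inv {x : ℤ_[p]} (hx : ‖x‖ ≤ (p : ℝ)⁻¹) : (p : ℤ_[p]) ∣ x :=
  (PadicInt.norm_lt_one_iff_dvd x).1 (hx.trans_lt inv_prime_lt_one)

/-- The Teichmüller sequence of a unit converges, to a limit congruent to the unit. -/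
theorem exists_tendsto_pow_prime_pow {x : ℚ_[p]} (hx : ‖x‖ ≤ 1) :
    ∃ T, Tendsto (fun n : ℕ => x ^ p ^ n) atTop (𝓝 T) ∧ ‖T - x‖ ≤ (p : ℝ)⁻¹ := by
  obtain ⟨x, rfl⟩ : ∃ z : ℤ_[p], (z : ℚ_[p]) = x := ⟨⟨x, hx⟩, rfl⟩
  have hstep : ∀ n : ℕ, ‖(x : ℚ_[p]) ^ p ^ (n + 1) - (x : ℚ_[p]) ^ p ^ n‖ ≤
      (p : ℝ)⁻¹ * ((p : ℝ)⁻¹) ^ n := fun n => by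
    have := norm_pow_prime_pow_sub_le (dvd_pow_prime_sub_self x) n
    rwa [PadicInt.coe_pow, ← pow_mul, ← pow_succ'] at this
  have hc : CauchySeq fun n : ℕ => (x : ℚ_[p]) ^ p ^ n :=
    cauchySeq_of_le_geometric (p : ℝ)⁻¹ (p : ℝ)⁻¹ inv_prime_lt_one fun n => by
      rw [dist_comm, dist_eq_norm]; exact hstep n
  obtain ⟨T, hT⟩ := cauchySeq_tendsto_of_complete hc
  refine ⟨T, hT, le_of_tendsto (hT.sub_const _).norm (.of_forall fun n => ?_)⟩
  induction n with
  | zero => simp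
  | succ n ih =>
    rw [← sub_add_sub_cancel _ ((x : ℚ_[p]) ^ p ^ n)]
    refine norm_add_le_of_le ((hstep n).trans ?_) ih
    exact mul_le_of_le_one_right (by positivity) (pow_le_one₀ (by positivity) inv_prime_lt_one.le)

theorem tendsto_one_add_pow_prime_pow {w : ℚ_[p]} (hw : ‖w‖ ≤ (p : ℝ)⁻¹) :
    Tendsto (fun n : ℕ => (1 + w) ^ p ^ n) atTop (𝓝 1) := by
  obtain ⟨w, rfl⟩ : ∃ z : ℤ_[p], (z : ℚ_[p]) = w :=
    ⟨⟨w, hw.trans inv_prime_lt_one.le⟩, rfl⟩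
  rw [tendsto_iff_norm_sub_tendsto_zero]
  refine squeeze_zero (fun _ => norm_nonneg _) (fun n => ?_)
    (by simpa using (tendsto_pow_atTop_nhds_zero_of_lt_one (by positivity)
      (inv_prime_lt_one (p := p))).const_mul (p : ℝ)⁻¹)
  have h : (p : ℤ_[p]) ∣ (1 + w) - 1 := by
    simpa using dvd_of_norm_le_inv hw
  simpa using norm_pow_prime_pow_sub_le h n

theorem norm_unitPart {x : ℚ_[p]} (hx : x ≠ 0) : ‖unitPart p x‖ = 1 := by
  have hp : (p : ℝ) ≠ 0 := by exact_mod_cast (Fact.out : p.Prime).ne_zero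
  rw [unitPart, norm_mul, norm_zpow, Padic.norm_p, Padic.norm_eq_zpow_neg_valuation hx,
    inv_zpow', neg_neg, ← zpow_add₀ hp, neg_add_cancel, zpow_zero]

theorem norm_one_add_eq_one {w : ℚ_[p]} (hw : ‖w‖ ≤ (p : ℝ)⁻¹) : ‖1 + w‖ = 1 := by
  have h : ‖w‖ < 1 := hw.trans_lt inv_prime_lt_one
  rw [Padic.add_eq_max_of_ne (by simpa using h.ne'), norm_one, max_eq_left h.le]

theorem valuation_eq_zero_of_norm_eq_one {x : ℚ_[p]} (hx : ‖x‖ = 1) : x.valuation = 0 := by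
  have hx0 : x ≠ 0 := by rintro rfl; simp at hx
  have hp : (1 : ℝ) < p := by exact_mod_cast (Fact.out : p.Prime).one_lt
  rw [Padic.norm_eq_zpow_neg_valuation hx0] at hx
  have := (zpow_eq_one_iff_right₀ (by positivity) hp.ne').1 hx
  omega

theorem norm_angle_sub_one_le {x : ℚ_[p]} (hx : x ≠ 0) : ‖angle p x - 1‖ ≤ (p : ℝ)⁻¹ := by
  obtain ⟨T, hT, hTx⟩ := exists_tendsto_pow_prime_pow (norm_unitPart hx).le
  have hT1 : ‖T‖ = 1 := by
    refine tendsto_nhds_unique hT.norm ?_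
    simp [norm_unitPart hx]
  have hT0 : T ≠ 0 := by rintro rfl; simp at hT1
  rw [angle, teich, hT.limUnder_eq, div_sub_one hT0, norm_div, hT1, div_one, norm_sub_rev]
  exact hTx

theorem angle_mul_one_add {x w : ℚ_[p]} (hx : x ≠ 0) (hw : ‖w‖ ≤ (p : ℝ)⁻¹) :
    angle p (x * (1 + w)) = angle p x * (1 + w) := by
  have hw1 := norm_one_add_eq_one hw
  have hw0 : 1 + w ≠ 0 := by intro h; simp [h] at hw1
  have hu : unitPart p (x * (1 + w)) = unitPart p x * (1 + w) := by
    rw [unitPart, unitPart, Padic.valuation_mul hx hw0, valuation_eq_zero_of_norm_eq_one hw1,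
      add_zero]
    ring
  obtain ⟨T, hT, -⟩ := exists_tendsto_pow_prime_pow (norm_unitPart hx).le
  have hT' : Tendsto (fun n : ℕ => (unitPart p x * (1 + w)) ^ p ^ n) atTop (𝓝 T) := by
    simpa [mul_pow] using hT.mul (tendsto_one_add_pow_prime_pow hw)
  rw [angle, angle, teich, teich, hu, hT.limUnder_eq, hT'.limUnder_eq]
  ring

theorem angle_of_norm_sub_one_le {y : ℚ_[p]} (hy : ‖y - 1‖ ≤ (p : ℝ)⁻¹) : angle p y = y := by
  have h1 : angle p (1 : ℚ_[p]) = 1 := by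
    have : Tendsto (fun _ : ℕ => (1 : ℚ_[p])) atTop (𝓝 1) := tendsto_const_nhds
    simp [angle, unitPart, teich, this.limUnder_eq]
  simpa [h1] using angle_mul_one_add one_ne_zero hy

end Angle

section Exp

variable {p : ℕ} [Fact p.Prime]

theorem norm_natCast_inv_le {n : ℕ} (hn : n ≠ 0) : ‖(n : ℚ_[p])‖⁻¹ ≤ n := by
  have hp : (p : ℝ) ≠ 0 := by exact_mod_cast (Fact.out : p.Prime).ne_zero
  rw [Padic.norm_eq_zpow_neg_valuation (by exact_mod_cast hn), Padic.valuation_natCast,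
    zpow_neg, inv_inv, zpow_natCast]
  exact_mod_cast Nat.le_of_dvd (Nat.pos_of_ne_zero hn) pow_padicValNat_dvd

/-- The radius of convergence of `t ↦ y ^ t` for `y ∈ 1 + pℤ_p`. -/
noncomputable def epowRadius (p : ℕ) : ℝ := (p : ℝ) ^ (((p : ℝ) - 2) / ((p : ℝ) - 1))

theorem one_lt_epowRadius (hp : Odd p) : 1 < epowRadius p := by
  have h2 : (2 : ℝ) < p := by
    have := (Fact.out : p.Prime).two_le
    obtain ⟨m, hm⟩ := hp
    exact_mod_cast (by omega : 2 < p)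
  exact Real.one_lt_rpow (by linarith) (div_pos (by linarith) (by linarith))

theorem norm_factorial_inv_mul_le (n : ℕ) :
    ‖(n.factorial : ℚ_[p])‖⁻¹ * ((p : ℝ)⁻¹) ^ n ≤ ((epowRadius p)⁻¹) ^ n := by
  have hp1 : (1 : ℝ) < p := by exact_mod_cast (Fact.out : p.Prime).one_lt
  have hp0 : (0 : ℝ) < p := by linarith
  have hle : (((p : ℝ) - 1) * padicValNat p n.factorial) ≤ n := by
    have h1 : (p - 1) * padicValNat p n.factorial ≤ n := by
      rw [sub_one_mul_padicValNat_factorial]; exact Nat.sub_le _ _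
    have h2 : (1 : ℕ) ≤ p := (Fact.out : p.Prime).one_lt.le
    exact_mod_cast (by push_cast [Nat.cast_sub h2] at *; exact_mod_cast h1 :
      ((p - 1 : ℕ) : ℝ) * padicValNat p n.factorial ≤ n)
  rw [Padic.norm_eq_zpow_neg_valuation (by exact_mod_cast n.factorial_ne_zero),
    Padic.valuation_natCast, zpow_neg, inv_inv, zpow_natCast, epowRadius, ← Real.rpow_neg hp0.le,
    ← Real.rpow_mul_natCast hp0.le, inv_pow, ← Real.rpow_natCast, ← Real.rpow_natCast,
    ← Real.rpow_neg hp0.le, ← Real.rpow_add hp0]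
  refine Real.rpow_le_rpow_of_exponent_le hp1.le ?_
  have h3 : (0 : ℝ) < p - 1 := by linarith
  have h4 : -(((p : ℝ) - 2) / (p - 1)) * n = n / (p - 1) - n := by field_simp; ring
  rw [h4, sub_eq_add_neg]
  gcongr
  rw [le_div_iff₀ h3]; linarith

/-- Re-expansion about `0` of a power series about `1` whose radius of convergence exceeds `1`. -/
theorem hasSum_recenter {a : ℕ → ℚ_[p]} {C ρ : ℝ} (hC : ∀ n, ‖a n‖ ≤ C * (ρ⁻¹) ^ n)
    (h1 : 1 < ρ) {s : ℚ_[p]} (hs : ‖s‖ < ρ) :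
    HasSum (fun m => (∑' n, a n * ((n.choose m : ℚ_[p]) * (-1) ^ m)) * s ^ m)
      (∑' n, a n * (1 - s) ^ n) := by
  have hρ : 0 < ρ := by linarith
  have hC0 : 0 ≤ C := by simpa using (norm_nonneg _).trans (hC 0)
  set t : ℝ := max 1 ‖s‖ with ht
  have ht1 : 1 ≤ t := le_max_left _ _
  set q : ℝ := ρ⁻¹ * t with hq
  have hq0 : 0 ≤ q := by positivity
  have hq1 : q < 1 := by
    rw [hq, inv_mul_lt_iff₀ hρ, mul_one]; exact max_lt h1 hs
  let F : ℕ × ℕ → ℚ_[p] := fun x =>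
    a x.1 * (((x.1.choose x.2 : ℕ) : ℚ_[p]) * (-1) ^ x.2) * s ^ x.2
  have hF : ∀ n m, ‖F (n, m)‖ ≤ if m ∈ Finset.range (n + 1) then C * q ^ n else 0 := fun n m => by
    split_ifs with hm
    · have hm' : m ≤ n := Nat.lt_succ_iff.1 (Finset.mem_range.1 hm)
      have hch : ‖((n.choose m : ℕ) : ℚ_[p])‖ ≤ 1 := by
        simpa using Padic.norm_int_le_one (p := p) ((n.choose m : ℕ) : ℤ)
      simp only [F, norm_mul, norm_pow, norm_neg, norm_one, one_pow, mul_one]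
      calc _ ≤ (C * ρ⁻¹ ^ n) * 1 * t ^ n := by
            gcongr
            · exact hC n
            · exact (pow_le_pow_left₀ (norm_nonneg _) (le_max_right _ _) m).trans
                (pow_le_pow_right₀ ht1 hm')
        _ = _ := by rw [hq, mul_pow]; ring
    · have : n.choose m = 0 := Nat.choose_eq_zero_of_lt (by simpa using hm)
      simp [F, this]
  have hB : Summable fun x : ℕ × ℕ =>
      if x.2 ∈ Finset.range (x.1 + 1) then C * q ^ x.1 else (0 : ℝ) := by
    rw [summable_prod_of_nonneg (fun x => by dsimp only; split_ifs <;> positivity)]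
    refine ⟨fun n => summable_of_ne_finset_zero (s := Finset.range (n + 1))
      fun m hm => if_neg hm, ?_⟩
    have : ∀ n : ℕ, ∑' m, (if m ∈ Finset.range (n + 1) then C * q ^ n else (0 : ℝ)) =
        C * ((n : ℝ) ^ 1 * q ^ n) + C * q ^ n := fun n => by
      rw [tsum_eq_sum (s := Finset.range (n + 1)) fun m hm => if_neg hm,
        Finset.sum_congr rfl fun m hm => if_pos hm]
      simp; ring
    simp only [this]
    exact ((summable_pow_mul_geometric_of_norm_lt_one 1
      (by rwa [Real.norm_of_nonneg hq0])).mul_left C).add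
      ((summable_geometric_of_lt_one hq0 hq1).mul_left C)
  have hS : Summable F := Summable.of_norm_bounded hB fun x => hF x.1 x.2
  have hrow : ∀ n, ∑' m, F (n, m) = a n * (1 - s) ^ n := fun n => by
    rw [tsum_eq_sum (s := Finset.range (n + 1)) fun m hm => by
      simpa [hm] using (hF n m).trans_eq (if_neg hm)]
    rw [sub_eq_neg_add, add_pow, Finset.mul_sum]
    refine Finset.sum_congr rfl fun m _ => ?_
    simp only [F, one_pow, neg_pow s]
    ring
  have hcol : ∀ m, ∑' n, F (n, m) = (∑' n, a n * ((n.choose m : ℚ_[p]) * (-1) ^ m)) * s ^ m :=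
    fun m => by rw [← tsum_mul_right]
  have hsw : Summable fun x : ℕ × ℕ => F (x.2, x.1) := hS.prod_symm
  have h := hsw.prod
  rw [← tsum_congr hrow, Summable.tsum_comm (f := fun m n => F (n, m)) hsw]
  simpa only [hcol] using h.hasSum

end Exp

end PZeta

namespace PZeta

section Integrand

variable {p : ℕ} [Fact p.Prime]

theorem EverywhereAnalytic.smoothBound {f : ℤ_[p] → ℤ_[p]} (hf : EverywhereAnalytic p f) :
    SmoothBound 1 fun a => (f a : ℚ_[p]) := by
  obtain ⟨c, hc1, hc0, hfc⟩ := hf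
  simp only [hfc]
  refine SmoothBound.tsum zero_le_one
    (fun k => ((SmoothBound.coe.pow k).const_mul (c k)).mono (by simpa using hc1 k)) fun x => ?_
  apply NonarchimedeanAddGroup.summable_of_tendsto_cofinite_zero
  rw [Nat.cofinite_eq_atTop]
  refine squeeze_zero_norm (fun k => ?_) (tendsto_zero_iff_norm_tendsto_zero.1 hc0)
  rw [norm_mul, norm_pow]
  exact mul_le_of_le_one_right (norm_nonneg _)
    (pow_le_one₀ (norm_nonneg _) (by simpa using x.norm_le_one))

theorem norm_inv_le_of_one_lt {x : ℚ_[p]} (hx : 1 < ‖x‖) : ‖x⁻¹‖ ≤ (p : ℝ)⁻¹ := by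
  have h := (Padic.norm_lt_pow_iff_norm_le_pow_sub_one x⁻¹ 0).1
    (by simpa using inv_lt_one_of_one_lt₀ hx)
  simpa using h

theorem succ_mul_inv_pow_succ_le (n : ℕ) :
    ((n : ℝ) + 1) * ((p : ℝ)⁻¹) ^ (n + 1) ≤ (p : ℝ)⁻¹ := by
  have hp0 : (0 : ℝ) < p := by exact_mod_cast (Fact.out : p.Prime).pos
  have h : ((n : ℝ) + 1) ≤ (p : ℝ) ^ n := by
    exact_mod_cast Nat.succ_le_of_lt (Nat.lt_pow_self (Fact.out : p.Prime).one_lt)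
  calc _ ≤ (p : ℝ) ^ n * ((p : ℝ)⁻¹) ^ (n + 1) := by gcongr
    _ = _ := by rw [pow_succ, inv_pow]; field_simp

theorem SmoothBound.padicLog {y : ℤ_[p] → ℚ_[p]} (hy : SmoothBound (p : ℝ)⁻¹ fun a => y a - 1) :
    SmoothBound (p : ℝ)⁻¹ fun a => padicLog p (y a) := by
  have hcoef : ∀ n : ℕ, ‖(-1 : ℚ_[p]) ^ n / ((n : ℚ_[p]) + 1)‖ ≤ (n : ℝ) + 1 := fun n => by
    have := norm_natCast_inv_le (p := p) n.succ_ne_zero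
    push_cast at this
    simpa [norm_div] using this
  have hterm : ∀ n : ℕ, SmoothBound (((n : ℝ) + 1) * ((p : ℝ)⁻¹) ^ (n + 1))
      fun a => (-1 : ℚ_[p]) ^ n * (angle p (y a) - 1) ^ (n + 1) / ((n : ℚ_[p]) + 1) := fun n => by
    have h := ((hy.pow (n + 1)).const_mul ((-1 : ℚ_[p]) ^ n / ((n : ℚ_[p]) + 1))).mono
      (mul_le_mul_of_nonneg_right (hcoef n) (by positivity))
    convert h using 2 with a
    rw [angle_of_norm_sub_one_le (hy.norm_le a)]
    ring
  refine SmoothBound.tsum (by positivity) (fun n => (hterm n).mono (succ_mul_inv_pow_succ_le n))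
    fun a => Summable.of_norm_bounded ?_ fun n => (hterm n).norm_le a
  have h1 := summable_pow_mul_geometric_of_norm_lt_one 1
    (r := (p : ℝ)⁻¹) (by simpa using inv_prime_lt_one (p := p))
  simpa using (summable_nat_add_iff 1).2 h1

theorem smoothBound_angle_add_sub_one {lam : ℚ_[p]} (hlam : 1 < ‖lam‖) {g : ℤ_[p] → ℚ_[p]}
    (hg : SmoothBound 1 g) : SmoothBound (p : ℝ)⁻¹ fun a => angle p (lam + g a) - 1 := by
  have hl0 : lam ≠ 0 := by rintro rfl; simp at hlam; linarith
  have hA := norm_angle_sub_one_le hl0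
  have hA1 : ‖angle p lam‖ = 1 := by simpa using norm_one_add_eq_one hA
  have hinv := norm_inv_le_of_one_lt hlam
  have h := (SmoothBound.const hA).add ((hg.const_mul (angle p lam * lam⁻¹)).mono
    (by simpa [hA1] using hinv))
  convert h using 2 with a
  have hw : ‖lam⁻¹ * g a‖ ≤ (p : ℝ)⁻¹ := by
    rw [norm_mul]
    exact (mul_le_of_le_one_right (norm_nonneg _) (hg.norm_le a)).trans hinv
  have e : lam + g a = lam * (1 + lam⁻¹ * g a) := by field_simp
  rw [e, angle_mul_one_add hl0 hw]
  ring

/-- Termwise Volkenborn integration of an exponential series. -/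
theorem tendsto_volkSum_exp (hp : Odd p) {L : ℤ_[p] → ℚ_[p]} (hL : SmoothBound (p : ℝ)⁻¹ L)
    {I : ℕ → ℚ_[p]} (hI : ∀ n, Tendsto (volkSum p fun a => L a ^ n) atTop (𝓝 (I n)))
    {t : ℚ_[p]} (ht : ‖t‖ < epowRadius p) :
    Tendsto (volkSum p fun a => ∑' n : ℕ, (t * L a) ^ n / (n.factorial : ℚ_[p])) atTop
      (𝓝 (∑' n : ℕ, I n / (n.factorial : ℚ_[p]) * t ^ n)) := by
  have hR : 0 < epowRadius p := one_pos.trans (one_lt_epowRadius hp)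
  have hq : ∀ (C : ℝ) (z : ℚ_[p]) (n : ℕ), 0 ≤ C → ‖z‖ ≤ ((p : ℝ)⁻¹) ^ n * C →
      ‖z / (n.factorial : ℚ_[p]) * t ^ n‖ ≤ C * ((epowRadius p)⁻¹ * ‖t‖) ^ n :=
    fun C z n hC hz => by
      rw [norm_mul, norm_div, norm_pow, div_eq_mul_inv, mul_pow]
      calc _ ≤ (((p : ℝ)⁻¹) ^ n * C) * ‖(n.factorial : ℚ_[p])‖⁻¹ * ‖t‖ ^ n := by gcongr
        _ = C * (‖(n.factorial : ℚ_[p])‖⁻¹ * ((p : ℝ)⁻¹) ^ n) * ‖t‖ ^ n := by ring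
        _ ≤ C * ((epowRadius p)⁻¹) ^ n * ‖t‖ ^ n := by
          gcongr; exact norm_factorial_inv_mul_le n
        _ = _ := by ring
  have hgeo : ∀ C : ℝ, Summable fun n : ℕ => C * ((epowRadius p)⁻¹ * ‖t‖) ^ n := fun C =>
    (summable_geometric_of_lt_one (by positivity)
      (by rwa [inv_mul_lt_iff₀ hR, mul_one])).mul_left C
  have hterm : ∀ (a : ℤ_[p]) (n : ℕ), (t * L a) ^ n / (n.factorial : ℚ_[p]) =
      L a ^ n / (n.factorial : ℚ_[p]) * t ^ n := fun a n => by ring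
  have hsum : ∀ a, Summable fun n : ℕ => L a ^ n / (n.factorial : ℚ_[p]) * t ^ n := fun a =>
    Summable.of_norm_bounded (hgeo 1) fun n => hq 1 _ n zero_le_one
      (by simpa using pow_le_pow_left₀ (norm_nonneg _) (hL.norm_le a) n)
  have hV : ∀ N, volkSum p (fun a => ∑' n : ℕ, (t * L a) ^ n / (n.factorial : ℚ_[p])) N =
      ∑' n : ℕ, volkSum p (fun a => L a ^ n) N / (n.factorial : ℚ_[p]) * t ^ n := fun N => by
    have h : HasSum (fun n => ∑ a ∈ Finset.range (p ^ N),
          L (a : ℤ_[p]) ^ n / (n.factorial : ℚ_[p]) * t ^ n)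
        (∑ a ∈ Finset.range (p ^ N), ∑' n : ℕ, (t * L (a : ℤ_[p])) ^ n / (n.factorial : ℚ_[p])) :=
      hasSum_sum fun a _ => by
        simp only [hterm]
        exact (hsum (a : ℤ_[p])).hasSum
    simp only [volkSum]
    rw [← h.tsum_eq, ← tsum_mul_left]
    refine tsum_congr fun n => ?_
    rw [← Finset.sum_mul, ← Finset.sum_div]
    ring
  refine Tendsto.congr (fun N => (hV N).symm) ?_
  have hlim : ∀ n, Tendsto (fun N => volkSum p (fun a => L a ^ n) N / (n.factorial : ℚ_[p]) * t ^ n)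
      atTop (𝓝 (I n / (n.factorial : ℚ_[p]) * t ^ n)) := fun n =>
    ((hI n).div_const _).mul_const _
  have hbound : ∀ N n, ‖volkSum p (fun a => L a ^ n) N / (n.factorial : ℚ_[p]) * t ^ n‖ ≤
      p * ((epowRadius p)⁻¹ * ‖t‖) ^ n := fun N n =>
    hq p _ n (Nat.cast_nonneg p) ((hL.pow n).norm_volkSum_le hp N)
  exact tendsto_tsum_of_dominated_convergence (hgeo p) hlim (.of_forall hbound)

end Integrand

end PZeta

/-- for an odd prime `p`, `‖λ‖ > 1` and `f` everywhere analytic with integral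
coefficients, there is a power series `Σ c_n s^n` converging for `‖s‖ < p^{(p-2)/(p-1)}`
whose sum is the Volkenborn integral `∫_{ℤ_p} ⟨λ+f(a)⟩^{1-s} da` (the power via the
exponential series); consequently `ζ_p^f(s,λ) = (s-1)⁻¹ ∫_{ℤ_p} ⟨λ+f(a)⟩^{1-s} da` is
analytic on that disc except for a simple pole at `s = 1`. -/
theorem zetaH_analytic_in_s (p : ℕ) [Fact p.Prime] (hp : Odd p)
    (lam : ℚ_[p]) (hlam : 1 < ‖lam‖)
    (f : ℤ_[p] → ℤ_[p]) (hf : EverywhereAnalytic p f) :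
    ∃ c : ℕ → ℚ_[p], ∀ s : ℚ_[p], ‖s‖ < (p : ℝ) ^ (((p : ℝ) - 2) / ((p : ℝ) - 1)) →
      Summable (fun n : ℕ => c n * s ^ n) ∧
      Filter.Tendsto
        (volkSum p fun a => epow p (angle p (lam + (f a : ℚ_[p]))) (1 - s))
        Filter.atTop (nhds (∑' n : ℕ, c n * s ^ n)) := by
  have hL := (smoothBound_angle_add_sub_one hlam hf.smoothBound).padicLog
  choose I hIn hI using fun n => (hL.pow n).exists_tendsto_volkSum hp
  refine ⟨fun m => ∑' n, I n / (n.factorial : ℚ_[p]) * ((n.choose m : ℚ_[p]) * (-1) ^ m),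
    fun s hs => ?_⟩
  have h1 := one_lt_epowRadius hp
  have ha : ∀ n, ‖I n / (n.factorial : ℚ_[p])‖ ≤ p * ((epowRadius p)⁻¹) ^ n := fun n => by
    rw [norm_div, div_eq_mul_inv]
    calc _ ≤ (((p : ℝ)⁻¹) ^ n * p) * ‖(n.factorial : ℚ_[p])‖⁻¹ := by gcongr; exact hIn n
      _ = p * (‖(n.factorial : ℚ_[p])‖⁻¹ * ((p : ℝ)⁻¹) ^ n) := by ring
      _ ≤ _ := by gcongr; exact norm_factorial_inv_mul_le n
  have hS := hasSum_recenter ha h1 hs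
  refine ⟨hS.summable, ?_⟩
  rw [hS.tsum_eq]
  have ht : ‖1 - s‖ < epowRadius p := by
    rw [sub_eq_add_neg]
    refine (IsUltrametricDist.norm_add_le_max _ _).trans_lt (max_lt (by simpa using h1) ?_)
    rwa [norm_neg]
  exact tendsto_volkSum_exp hp hL hI ht
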